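/- arXiv:1301.4154 — 2 statements merged into one kernel-verified Lean document; each statement's English description precedes it below -/
import Mathlib

section
/- If B is an algebra in the category of left H-modules and a coalgebra in the category of left H-comodules, and additionally: B is a coalgebra in left H-modules, an algebra in left H-comodules, ε_B is an algebra map, Δ_B(1_B)=1_B⊗1_B, Δ_B(ab) = Σ a₁((a₂)₍₋₁₎·b₁) ⊗ (a₂)₍₀₎ b₂, and the Yetter–Drinfeld compatibility Σ h₁ b₍₋₁₎ ⊗ h₂·b₍₀₎ = Σ (h₁·b)₍₋₁₎ h₂ ⊗ (h₁·b)₍₀₎ holds, then the smash product algebra structure and smash coproduct coalgebra structure make B ⋆ H = B ⊗ H a bialgebra. -/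
open TensorProduct

noncomputable section

/-- The smash product multiplication on `B ⊗ H`, sending
`(a ⊗ g) ⊗ (b ⊗ h)` to `Σ a (g₁ · b) ⊗ g₂ h`. -/
def smashMul (k : Type*) {H B : Type*} [Field k] [Semiring H] [Bialgebra k H]
    [Ring B] [Algebra k B] (α : H →ₗ[k] B →ₗ[k] B) :
    ((B ⊗[k] H) ⊗[k] (B ⊗[k] H)) →ₗ[k] B ⊗[k] H :=
  (TensorProduct.map
      ((LinearMap.mul' k B) ∘ₗ (TensorProduct.map LinearMap.id (TensorProduct.lift α))
        ∘ₗ (TensorProduct.assoc k B H B).toLinearMap)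
      (LinearMap.mul' k H))
    ∘ₗ (TensorProduct.tensorTensorTensorComm k (B ⊗[k] H) H B H).toLinearMap
    ∘ₗ (TensorProduct.map (TensorProduct.assoc k B H H).symm.toLinearMap LinearMap.id)
    ∘ₗ (TensorProduct.map (TensorProduct.map LinearMap.id Coalgebra.comul) LinearMap.id)

/-- The smash coproduct comultiplication on `B ⊗ H`, sending
`b ⊗ h` to `Σ b₁ ⊗ (b₂)₍₋₁₎ h₁ ⊗ ((b₂)₍₀₎ ⊗ h₂)`. -/
def smashComul (k : Type*) {H B : Type*} [Field k] [Semiring H] [Bialgebra k H]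
    [AddCommGroup B] [Module k B] [Coalgebra k B] (ρ : B →ₗ[k] H ⊗[k] B) :
    (B ⊗[k] H) →ₗ[k] ((B ⊗[k] H) ⊗[k] (B ⊗[k] H)) :=
  (TensorProduct.map
      ((TensorProduct.map LinearMap.id (LinearMap.mul' k H))
        ∘ₗ (TensorProduct.assoc k B H H).toLinearMap)
      LinearMap.id)
  ∘ₗ (TensorProduct.tensorTensorTensorComm k (B ⊗[k] H) B H H).toLinearMap
  ∘ₗ (TensorProduct.map
        ((TensorProduct.assoc k B H B).symm.toLinearMap
          ∘ₗ (TensorProduct.map LinearMap.id ρ))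
        LinearMap.id)
  ∘ₗ (TensorProduct.map Coalgebra.comul Coalgebra.comul)

/-- The counit `ε(b ⊗ h) = ε_B(b) ε_H(h)` of the smash coproduct. -/
def smashCounit (k : Type*) {H B : Type*} [Field k] [Semiring H] [Bialgebra k H]
    [AddCommGroup B] [Module k B] [Coalgebra k B] :
    (B ⊗[k] H) →ₗ[k] k :=
  (LinearMap.mul' k k) ∘ₗ (TensorProduct.map Coalgebra.counit Coalgebra.counit)


set_option linter.all false
set_option linter.unusedSectionVars false
set_option linter.unusedSimpArgs false
set_option linter.unusedTactic false
set_option linter.unreachableTactic false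

namespace RadfordAux

section
variable {k : Type*} [Field k]
variable {M N P Q R : Type*} [AddCommMonoid M] [AddCommMonoid N] [AddCommMonoid P]
  [AddCommMonoid Q] [AddCommMonoid R]
  [Module k M] [Module k N] [Module k P] [Module k Q] [Module k R]

/-- Sum over a chosen presentation of a tensor (Sweedler notation). -/
def S (x : M ⊗[k] N) (f : M → N → P) : P :=
  ∑ i ∈ (TensorProduct.exists_finset x).choose, f i.1 i.2

theorem S_eta (x : M ⊗[k] N) : S x (fun u v => u ⊗ₜ[k] v) = x :=
  (TensorProduct.exists_finset x).choose_spec.symm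

theorem S_congr {x : M ⊗[k] N} {f g : M → N → P} (h : ∀ u v, f u v = g u v) : S x f = S x g := by
  have : f = g := by funext u v; exact h u v
  rw [this]

theorem map_S (L : P →ₗ[k] Q) (x : M ⊗[k] N) (f : M → N → P) :
    L (S x f) = S x (fun u v => L (f u v)) := by
  simp only [S, map_sum]

theorem mapE_S (L : P ≃ₗ[k] Q) (x : M ⊗[k] N) (f : M → N → P) :
    L (S x f) = S x (fun u v => L (f u v)) := by
  simp only [S, map_sum]

theorem S_tm (x : M ⊗[k] N) (f : M → N → P) (q : Q) :
    (S x f) ⊗ₜ[k] q = S x (fun u v => f u v ⊗ₜ[k] q) := by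
  simp only [S, TensorProduct.sum_tmul]

theorem tm_S (x : M ⊗[k] N) (f : M → N → P) (q : Q) :
    q ⊗ₜ[k] (S x f) = S x (fun u v => q ⊗ₜ[k] f u v) := by
  simp only [S, TensorProduct.tmul_sum]

theorem S_swap (x : M ⊗[k] N) (y : P ⊗[k] Q) (f : M → N → P → Q → R) :
    S x (fun u v => S y (fun p q => f u v p q)) = S y (fun p q => S x (fun u v => f u v p q)) :=
  Finset.sum_comm

variable (k) in
/-- Unbundled linearity. -/
def Lin (f : M → N) : Prop := IsLinearMap k f

theorem lin_id : Lin k (fun x : M => x) := ⟨fun _ _ => rfl, fun _ _ => rfl⟩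

theorem lin_app (L : N →ₗ[k] P) {p : M → N} (h : Lin k p) : Lin k (fun x => L (p x)) :=
  ⟨fun a b => by rw [h.1, map_add], fun c a => by rw [h.2, map_smul]⟩

theorem lin_app2 (L : N →ₗ[k] P →ₗ[k] Q) (c : P) {p : M → N} (h : Lin k p) :
    Lin k (fun x => L (p x) c) :=
  lin_app (L.flip c) h

theorem lin_tl {p : M → N} (h : Lin k p) (q : P) : Lin k (fun x => p x ⊗ₜ[k] q) :=
  lin_app2 (TensorProduct.mk k N P) q h

theorem lin_tr {p : M → N} (h : Lin k p) (q : P) : Lin k (fun x => q ⊗ₜ[k] p x) :=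
  lin_app (TensorProduct.mk k P N q) h

theorem lin_ml {A : Type*} [Semiring A] [Algebra k A] {p : M → A} (h : Lin k p) (q : A) :
    Lin k (fun x => p x * q) :=
  lin_app2 (LinearMap.mul k A) q h

theorem lin_mr {A : Type*} [Semiring A] [Algebra k A] {p : M → A} (h : Lin k p) (q : A) :
    Lin k (fun x => q * p x) :=
  lin_app (LinearMap.mul k A q) h

theorem lin_sl {p : M → k} (h : Lin k p) (q : N) : Lin k (fun x => p x • q) :=
  ⟨fun a b => by rw [h.1, add_smul], fun c a => by rw [h.2, smul_assoc]⟩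

theorem lin_sr {p : M → N} (h : Lin k p) (q : k) : Lin k (fun x => q • p x) :=
  ⟨fun a b => by rw [h.1, smul_add], fun c a => by rw [h.2, smul_comm]⟩

theorem lin_Sr (x : M ⊗[k] N) {f : P → M → N → Q} (h : ∀ u v, Lin k (fun p => f p u v)) :
    Lin k (fun p => S x (f p)) :=
  ⟨fun a b => by simp only [S, (h _ _).1, Finset.sum_add_distrib],
   fun c a => by simp only [S, (h _ _).2, Finset.smul_sum]⟩

variable (k) in
/-- Unbundled bilinearity. -/
def Bi (f : M → N → P) : Prop := (∀ v, Lin k (fun u => f u v)) ∧ ∀ u, Lin k (fun v => f u v)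

/-- The bundled bilinear map. -/
def Bi.mk {f : M → N → P} (h : Bi k f) : M →ₗ[k] N →ₗ[k] P :=
  LinearMap.mk₂ k f (fun a b c => (h.1 c).1 a b) (fun a b c => (h.1 c).2 a b)
    (fun a b c => (h.2 a).1 b c) (fun a b c => (h.2 b).2 a c)

theorem S_lift {f : M → N → P} (h : Bi k f) (x : M ⊗[k] N) :
    S x f = TensorProduct.lift h.mk x := by
  conv_rhs => rw [← S_eta x, map_S]
  rfl

theorem lin_Sl {f : M → N → Q} {p : P → M ⊗[k] N} (h : Lin k p) 
    (h1 : ∀ v, Lin k (fun u => f u v)) (h2 : ∀ u, Lin k (fun v => f u v)) :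
    Lin k (fun x => S (p x) f) := by
  have : (fun x => S (p x) f) = fun x => TensorProduct.lift (Bi.mk ⟨h1, h2⟩) (p x) := by
    funext x; exact S_lift ⟨h1, h2⟩ _
  rw [this]
  exact lin_app _ h

theorem S_tmul {f : M → N → P} (h : Bi k f) (u : M) (v : N) : S (u ⊗ₜ[k] v) f = f u v := by
  rw [S_lift h]; rfl

theorem S_S {f : M → N → P} (h : Bi k f) (x : Q ⊗[k] R) (g : Q → R → M ⊗[k] N) :
    S (S x g) f = S x (fun u v => S (g u v) f) := by
  rw [S_lift h, map_S]
  exact S_congr fun u v => (S_lift h _).symm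

theorem S_S1 {f : M → N → P} (h : Bi k f) (x : Q ⊗[k] R) (g : Q → R → M) (g' : Q → R → N) :
    S (S x (fun u v => g u v ⊗ₜ[k] g' u v)) f = S x (fun u v => f (g u v) (g' u v)) := by
  rw [S_S h]
  exact S_congr fun u v => S_tmul h _ _

variable (k) in
/-- Unbundled trilinearity. -/
def Tri (f : M → N → P → Q) : Prop :=
  (∀ v w, Lin k (fun u => f u v w)) ∧ (∀ u w, Lin k (fun v => f u v w)) ∧
    ∀ u v, Lin k (fun w => f u v w)

/-- Bundled map on the right-nested triple tensor product. -/
theorem Tri.exists {f : M → N → P → Q} (h : Tri k f) :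
    ∃ F : M ⊗[k] (N ⊗[k] P) →ₗ[k] Q, ∀ u v w, F (u ⊗ₜ (v ⊗ₜ w)) = f u v w := by
  refine ⟨TensorProduct.lift (Bi.mk (f := fun u y => S y (fun v w => f u v w)) ⟨?_, ?_⟩), ?_⟩
  · exact fun y => lin_Sr y fun v w => h.1 v w
  · exact fun u => lin_Sl lin_id (h.2.1 u) (h.2.2 u)
  · intro u v w
    exact S_tmul (f := fun v w => f u v w) ⟨h.2.1 u, h.2.2 u⟩ v w

end

section
variable {k H B : Type*} [Field k] [Semiring H] [Bialgebra k H]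
    [Ring B] [Algebra k B] [Coalgebra k B]
variable {P : Type*} [AddCommMonoid P] [Module k P]

local notation "Δ" => Coalgebra.comul (R := k)
local notation "ε" => Coalgebra.counit (R := k)

theorem coassoc_S {C : Type*} [AddCommMonoid C] [Module k C] [Coalgebra k C]
    {f : C → C → C → P} (hf : Tri k f) (c : C) :
    S (Δ c) (fun c1 c2 => S (Δ c1) (fun c11 c12 => f c11 c12 c2)) =
    S (Δ c) (fun c1 c2 => S (Δ c2) (fun c21 c22 => f c1 c21 c22)) := by
  obtain ⟨F, hF⟩ := hf.exists
  have := congrArg F (Coalgebra.coassoc_apply (R := k) c)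
  conv_lhs at this => rw [← S_eta (Δ c)]
  conv_rhs at this => rw [← S_eta (Δ c)]
  simp only [map_S, mapE_S, LinearMap.rTensor_tmul, LinearMap.lTensor_tmul] at this
  convert this using 4 with c1 c2 c1 c2
  · conv_rhs => rw [← S_eta (Δ c1)]
    simp only [map_S, mapE_S, S_tm, TensorProduct.assoc_tmul, hF]
  · conv_rhs => rw [← S_eta (Δ c2)]
    simp only [map_S, mapE_S, tm_S, hF]

theorem counit_S {C : Type*} [AddCommMonoid C] [Module k C] [Coalgebra k C]
    (c : C) : S (Δ c) (fun c1 c2 => ε c1 • c2) = c := by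
  have := congrArg (TensorProduct.lid k C) (Coalgebra.rTensor_counit_comul (R := k) c)
  conv_lhs at this => rw [← S_eta (Δ c)]
  simpa only [map_S, mapE_S, LinearMap.rTensor_tmul, TensorProduct.lid_tmul, one_smul] using this

theorem counit_S' {C : Type*} [AddCommMonoid C] [Module k C] [Coalgebra k C]
    (c : C) : S (Δ c) (fun c1 c2 => ε c2 • c1) = c := by
  have := congrArg (TensorProduct.rid k C) (Coalgebra.lTensor_counit_comul (R := k) c)
  conv_lhs at this => rw [← S_eta (Δ c)]
  simpa only [map_S, mapE_S, LinearMap.lTensor_tmul, TensorProduct.rid_tmul, one_smul] using this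

theorem comul_mul_S {f : H → H → P} (hf : Bi k f) (g h : H) :
    S (Δ (g * h)) f = S (Δ g) (fun g1 g2 => S (Δ h) (fun h1 h2 => f (g1 * h1) (g2 * h2))) := by
  have : Δ (g * h) =
      S (Δ g) (fun g1 g2 => S (Δ h) (fun h1 h2 => (g1 * h1) ⊗ₜ[k] (g2 * h2))) := by
    rw [Bialgebra.comul_mul]
    conv_lhs => rw [← S_eta (Δ g), ← S_eta (Δ h)]
    simp only [S, Finset.sum_mul, Finset.mul_sum, Algebra.TensorProduct.tmul_mul_tmul]
    rw [Finset.sum_comm]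
  rw [this, S_S hf]
  exact S_congr fun u v => S_S1 hf _ _ _

theorem smashMul_S (α : H →ₗ[k] B →ₗ[k] B) (a b : B) (g h : H) :
    smashMul k α ((a ⊗ₜ[k] g) ⊗ₜ[k] (b ⊗ₜ[k] h)) =
      S (Δ g) (fun g1 g2 => (a * α g1 b) ⊗ₜ[k] (g2 * h)) := by
  simp only [smashMul, LinearMap.comp_apply, TensorProduct.map_tmul, LinearMap.id_apply]
  conv_lhs => rw [← S_eta (Δ g)]
  simp only [map_S, mapE_S, S_tm, tm_S, LinearEquiv.coe_coe, TensorProduct.assoc_symm_tmul,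
    TensorProduct.map_tmul, LinearMap.id_apply, TensorProduct.tensorTensorTensorComm_tmul,
    LinearMap.comp_apply, TensorProduct.assoc_tmul, TensorProduct.lift.tmul, LinearMap.mul'_apply]

theorem smashComul_S (ρ : B →ₗ[k] H ⊗[k] B) (b : B) (h : H) :
    smashComul k ρ (b ⊗ₜ[k] h) =
      S (Δ b) (fun b1 b2 => S (ρ b2) (fun u v => S (Δ h) (fun h1 h2 =>
        (b1 ⊗ₜ[k] (u * h1)) ⊗ₜ[k] (v ⊗ₜ[k] h2)))) := by
  simp only [smashComul, LinearMap.comp_apply, TensorProduct.map_tmul, LinearMap.id_apply]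
  conv_lhs => rw [← S_eta (Δ b)]
  simp only [map_S, mapE_S, S_tm, tm_S, LinearEquiv.coe_coe, 
    TensorProduct.map_tmul, LinearMap.id_apply, LinearMap.comp_apply]
  refine S_congr fun b1 b2 => ?_
  conv_lhs => rw [← S_eta (ρ b2), ← S_eta (Δ h)]
  simp only [map_S, mapE_S, S_tm, tm_S, LinearEquiv.coe_coe, TensorProduct.assoc_symm_tmul,
    TensorProduct.map_tmul, LinearMap.id_apply, TensorProduct.tensorTensorTensorComm_tmul,
    LinearMap.comp_apply, TensorProduct.assoc_tmul, TensorProduct.lift.tmul, LinearMap.mul'_apply]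
  try rw [S_swap]

variable (α : H →ₗ[k] B →ₗ[k] B) (ρ : B →ₗ[k] H ⊗[k] B)

/-- Hypothesis `hma` of the main theorem. -/
abbrev ModAlg : Prop :=
    ∀ (h : H) (a b : B),
      α h (a * b) =
        LinearMap.mul' k B (TensorProduct.map (α.flip a) (α.flip b) (Coalgebra.comul h))

/-- Hypothesis `hmc` of the main theorem. -/
abbrev ModCoalg : Prop :=
    ∀ (h : H) (b : B),
      Coalgebra.comul (R := k) (α h b) =
        (TensorProduct.map (TensorProduct.lift α) (TensorProduct.lift α))
          ((TensorProduct.tensorTensorTensorComm k H H B B)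
            (Coalgebra.comul h ⊗ₜ[k] Coalgebra.comul b))

/-- Hypothesis `hρ_coassoc` of the main theorem. -/
abbrev ComodCoassoc : Prop :=
    (TensorProduct.assoc k H H B).toLinearMap
        ∘ₗ (TensorProduct.map Coalgebra.comul LinearMap.id) ∘ₗ ρ
      = (TensorProduct.map LinearMap.id ρ) ∘ₗ ρ

/-- Hypothesis `hca` of the main theorem. -/
abbrev ComodAlg : Prop :=
    ∀ a b : B,
      ρ (a * b) = (TensorProduct.map (LinearMap.mul' k H) (LinearMap.mul' k B))
        ((TensorProduct.tensorTensorTensorComm k H B H B) (ρ a ⊗ₜ[k] ρ b))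

/-- Hypothesis `hcc` of the main theorem. -/
abbrev ComodCoalg : Prop :=
    ∀ b : B,
      (TensorProduct.map LinearMap.id Coalgebra.comul) (ρ b)
        = (TensorProduct.map (LinearMap.mul' k H) LinearMap.id)
            ((TensorProduct.tensorTensorTensorComm k H B H B)
              ((TensorProduct.map ρ ρ) (Coalgebra.comul b)))

/-- Hypothesis `htw` of the main theorem. -/
abbrev Twisted : Prop :=
    ∀ a b : B,
      Coalgebra.comul (R := k) (a * b) =
        (TensorProduct.map
            ((LinearMap.mul' k B)
              ∘ₗ (TensorProduct.map LinearMap.id (TensorProduct.lift α))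
              ∘ₗ (TensorProduct.assoc k B H B).toLinearMap)
            (LinearMap.mul' k B))
          ((TensorProduct.tensorTensorTensorComm k (B ⊗[k] H) B B B)
            ((TensorProduct.map
                ((TensorProduct.assoc k B H B).symm.toLinearMap
                  ∘ₗ (TensorProduct.map LinearMap.id ρ))
                LinearMap.id)
              (Coalgebra.comul a ⊗ₜ[k] Coalgebra.comul b)))

/-- Hypothesis `hYD` of the main theorem. -/
abbrev YetterDrinfeld : Prop :=
    ∀ (h : H) (b : B),
      (TensorProduct.map (LinearMap.mul' k H) (TensorProduct.lift α))
          ((TensorProduct.tensorTensorTensorComm k H H H B)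
            (Coalgebra.comul h ⊗ₜ[k] ρ b))
        = ((TensorProduct.map (LinearMap.mul' k H) LinearMap.id)
            ∘ₗ (TensorProduct.assoc k H H B).symm.toLinearMap
            ∘ₗ (TensorProduct.map LinearMap.id (TensorProduct.comm k B H).toLinearMap)
            ∘ₗ (TensorProduct.assoc k H B H).toLinearMap
            ∘ₗ (TensorProduct.map (ρ ∘ₗ α.flip b) LinearMap.id))
          (Coalgebra.comul h)

/-- Hypothesis `hccε` of the main theorem. -/
abbrev ComodCounit : Prop :=
    ∀ b : B,
      (TensorProduct.rid k H) ((TensorProduct.map LinearMap.id Coalgebra.counit) (ρ b))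
        = Coalgebra.counit (R := k) b • (1 : H)

/-- Hypothesis `hρ_counit` of the main theorem. -/
abbrev ComodCounital : Prop :=
    (TensorProduct.lid k B).toLinearMap
        ∘ₗ (TensorProduct.map Coalgebra.counit LinearMap.id) ∘ₗ ρ = LinearMap.id

theorem ma_S (hma : ModAlg α)
    (h : H) (a b : B) : α h (a * b) = S (Δ h) (fun h1 h2 => α h1 a * α h2 b) := by
  rw [hma]
  conv_lhs => rw [← S_eta (Δ h)]
  simp only [map_S, TensorProduct.map_tmul, LinearMap.mul'_apply, LinearMap.flip_apply]

theorem mc_S (hmc : ModCoalg α)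
    {f : B → B → P} (hf : Bi k f) (h : H) (b : B) :
    S (Δ (α h b)) f =
      S (Δ h) (fun h1 h2 => S (Δ b) (fun b1 b2 => f (α h1 b1) (α h2 b2))) := by
  have : Δ (α h b) = S (Δ h) (fun h1 h2 => S (Δ b) (fun b1 b2 => 
      (α h1 b1) ⊗ₜ[k] (α h2 b2))) := by
    rw [hmc]
    conv_lhs => rw [← S_eta (Δ h), ← S_eta (Δ b)]
    simp only [map_S, mapE_S, S_tm, tm_S, TensorProduct.map_tmul, 
      TensorProduct.tensorTensorTensorComm_tmul, TensorProduct.lift.tmul]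
    try rw [S_swap]
  rw [this, S_S hf]
  exact S_congr fun u v => S_S1 hf _ _ _

theorem rcoassoc_S (hρ_coassoc : ComodCoassoc ρ)
    {f : H → H → B → P} (hf : Tri k f) (b : B) :
    S (ρ b) (fun u v => S (Δ u) (fun u1 u2 => f u1 u2 v)) =
    S (ρ b) (fun u v => S (ρ v) (fun p q => f u p q)) := by
  obtain ⟨F, hF⟩ := hf.exists
  have := congrArg F (LinearMap.congr_fun hρ_coassoc b)
  simp only [LinearMap.comp_apply] at this
  conv_lhs at this => rw [← S_eta (ρ b)]
  conv_rhs at this => rw [← S_eta (ρ b)]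
  simp only [map_S, mapE_S, TensorProduct.map_tmul, LinearMap.id_apply, LinearEquiv.coe_coe] at this
  convert this using 4 with c1 c2 c1 c2
  · conv_rhs => rw [← S_eta (Δ c1)]
    simp only [map_S, mapE_S, S_tm, TensorProduct.assoc_tmul, hF]
  · conv_rhs => rw [← S_eta (ρ c2)]
    simp only [map_S, mapE_S, tm_S, hF]

theorem rcounit_S (hρ_counit : ComodCounital ρ) (b : B) :
    S (ρ b) (fun u v => ε u • v) = b := by
  have := LinearMap.congr_fun hρ_counit b
  simp only [LinearMap.comp_apply] at this
  conv_lhs at this => rw [← S_eta (ρ b)]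
  simpa only [map_S, mapE_S, TensorProduct.map_tmul, LinearMap.id_apply, LinearEquiv.coe_coe,
    TensorProduct.lid_tmul] using this

theorem ca_S (hca : ComodAlg ρ)
    {f : H → B → P} (hf : Bi k f) (a b : B) :
    S (ρ (a * b)) f =
      S (ρ a) (fun u v => S (ρ b) (fun p q => f (u * p) (v * q))) := by
  have : ρ (a * b) = S (ρ a) (fun u v => S (ρ b) (fun p q => (u * p) ⊗ₜ[k] (v * q))) := by
    rw [hca]
    conv_lhs => rw [← S_eta (ρ a), ← S_eta (ρ b)]
    simp only [map_S, mapE_S, S_tm, tm_S, TensorProduct.map_tmul, 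
      TensorProduct.tensorTensorTensorComm_tmul, LinearMap.mul'_apply]
    try rw [S_swap]
  rw [this, S_S hf]
  exact S_congr fun u v => S_S1 hf _ _ _

theorem cc_S (hcc : ComodCoalg ρ)
    {f : H → B → B → P} (hf : Tri k f) (b : B) :
    S (ρ b) (fun u v => S (Δ v) (fun v1 v2 => f u v1 v2)) =
    S (Δ b) (fun b1 b2 => S (ρ b1) (fun u v => S (ρ b2) (fun p q => f (u * p) v q))) := by
  obtain ⟨F, hF⟩ := hf.exists
  have := congrArg F (hcc b)
  conv_lhs at this => rw [← S_eta (ρ b)]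
  conv_rhs at this => rw [← S_eta (Δ b)]
  simp only [map_S, mapE_S, TensorProduct.map_tmul, LinearMap.id_apply] at this
  convert this using 4 with c1 c2 c1 c2
  · conv_rhs => rw [← S_eta (Δ c2)]
    simp only [map_S, mapE_S, tm_S, hF]
  · conv_rhs => rw [← S_eta (ρ c1), ← S_eta (ρ c2)]
    simp only [map_S, mapE_S, S_tm, tm_S, TensorProduct.map_tmul, LinearMap.id_apply,
      TensorProduct.tensorTensorTensorComm_tmul, LinearMap.mul'_apply, hF]
    try rw [S_swap]

theorem ccε_S (hccε : ComodCounit ρ) (b : B) :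
    S (ρ b) (fun u v => ε v • u) = ε b • (1 : H) := by
  rw [← hccε]
  conv_rhs => rw [← S_eta (ρ b)]
  simp only [map_S, mapE_S, TensorProduct.map_tmul, LinearMap.id_apply, TensorProduct.rid_tmul]

theorem tw_S (htw : Twisted α ρ)
    {f : B → B → P} (hf : Bi k f) (a b : B) :
    S (Δ (a * b)) f = S (Δ a) (fun a1 a2 => S (ρ a2) (fun u v => S (Δ b) (fun b1 b2 =>
      f (a1 * α u b1) (v * b2)))) := by
  have : Δ (a * b) = S (Δ a) (fun a1 a2 => S (ρ a2) (fun u v => S (Δ b) (fun b1 b2 =>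
      (a1 * α u b1) ⊗ₜ[k] (v * b2)))) := by
    rw [htw]
    conv_lhs => rw [← S_eta (Δ a)]
    simp only [map_S, mapE_S, S_tm, TensorProduct.map_tmul, LinearMap.comp_apply,
      LinearMap.id_apply]
    refine S_congr fun a1 a2 => ?_
    conv_lhs => rw [← S_eta (ρ a2), ← S_eta (Δ b)]
    simp only [map_S, mapE_S, S_tm, tm_S, TensorProduct.map_tmul, LinearMap.comp_apply,
      LinearEquiv.coe_coe, TensorProduct.assoc_symm_tmul, TensorProduct.assoc_tmul,
      TensorProduct.tensorTensorTensorComm_tmul, TensorProduct.lift.tmul, LinearMap.id_apply,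
      LinearMap.mul'_apply]
    try rw [S_swap]
  rw [this, S_S hf]
  refine S_congr fun u v => ?_
  rw [S_S hf]
  exact S_congr fun u v => S_S1 hf _ _ _

theorem YD_S (hYD : YetterDrinfeld α ρ)
    {f : H → B → P} (hf : Bi k f) (h : H) (b : B) :
    S (Δ h) (fun h1 h2 => S (ρ (α h1 b)) (fun u v => f (u * h2) v)) =
    S (Δ h) (fun h1 h2 => S (ρ b) (fun u v => f (h1 * u) (α h2 v))) := by
  have := congrArg (TensorProduct.lift hf.mk) (hYD h b)
  conv_lhs at this => rw [← S_eta (Δ h), ← S_eta (ρ b)]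
  conv_rhs at this => rw [← S_eta (Δ h)]
  simp only [map_S, mapE_S, S_tm, tm_S, TensorProduct.map_tmul, LinearMap.comp_apply,
      LinearEquiv.coe_coe, TensorProduct.assoc_symm_tmul, TensorProduct.assoc_tmul,
      TensorProduct.tensorTensorTensorComm_tmul, TensorProduct.lift.tmul, LinearMap.id_apply,
      LinearMap.mul'_apply, LinearMap.flip_apply] at this
  rw [S_swap] at this
  refine Eq.trans ?_ (this.symm.trans ?_)
  · refine S_congr fun h1 h2 => ?_
    conv_rhs => rw [← S_eta (ρ (α h1 b))]
    simp only [map_S, mapE_S, S_tm, tm_S, TensorProduct.map_tmul, 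
      TensorProduct.assoc_symm_tmul, TensorProduct.assoc_tmul, TensorProduct.comm_tmul,
      TensorProduct.lift.tmul, LinearMap.id_apply, LinearEquiv.coe_coe,
      LinearMap.mul'_apply, LinearMap.flip_apply]
    rfl
  · first | rfl | (rw [S_swap]; rfl)

theorem S_pull {M N Q R : Type*} [AddCommMonoid M] [AddCommMonoid N] [Module k M] [Module k N]
    [AddCommMonoid Q] [AddCommMonoid R] [Module k Q] [Module k R]
    {x : M ⊗[k] N} {y : Q ⊗[k] R} {f : M → N → P} {g : M → N → Q → R → P}
    (h : ∀ u v, f u v = S y (g u v)) :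
    S x f = S y (fun p q => S x (fun u v => g u v p q)) :=
  (S_congr h).trans (S_swap x y g)

theorem smul_S {M N : Type*} [AddCommMonoid M] [AddCommMonoid N] [Module k M] [Module k N]
    (c : k) (x : M ⊗[k] N) (f : M → N → P) :
    c • S x f = S x (fun u v => c • f u v) := by
  simp only [S, Finset.smul_sum]

theorem S_mul {M N : Type*} [AddCommMonoid M] [AddCommMonoid N] [Module k M] [Module k N]
    (c : H) (x : M ⊗[k] N) (f : M → N → H) :
    S x f * c = S x (fun u v => f u v * c) := by
  simp only [S, Finset.sum_mul]

theorem mul_assoc_aux 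
    (hα_mul : ∀ (g h : H) (b : B), α (g * h) b = α g (α h b))
    (hma : ModAlg α)
    (a b c : B) (g h l : H) :
    smashMul k α (smashMul k α ((a ⊗ₜ[k] g) ⊗ₜ[k] (b ⊗ₜ[k] h)) ⊗ₜ[k] (c ⊗ₜ[k] l)) =
    smashMul k α ((a ⊗ₜ[k] g) ⊗ₜ[k] smashMul k α ((b ⊗ₜ[k] h) ⊗ₜ[k] (c ⊗ₜ[k] l))) := by
  simp only [smashMul_S, S_tm, tm_S, map_S]
  calc _ = S (Δ g) (fun g1 g2 => S (Δ h) (fun h1 h2 => S (Δ g2) (fun g21 g22 => 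
      (a * α g1 b * α (g21 * h1) c) ⊗ₜ[k] (g22 * h2 * l)))) := by
        refine S_congr fun g1 g2 => ?_
        rw [comul_mul_S, S_swap]
        repeat' (first | exact lin_id | apply And.intro | intro _ | apply lin_tl | apply lin_tr | apply lin_ml | apply lin_mr | apply lin_app2 | apply lin_app | apply lin_Sr | apply lin_Sl)
    _ = S (Δ h) (fun h1 h2 => S (Δ g) (fun g1 g2 => S (Δ g2) (fun g21 g22 => 
      (a * α g1 b * α (g21 * h1) c) ⊗ₜ[k] (g22 * h2 * l)))) := by
        rw [S_swap]
    _ = _ := by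
        refine S_congr fun h1 h2 => ?_
        rw [← coassoc_S (f := fun x y z => (a * α x b * α (y * h1) c) ⊗ₜ[k] (z * h2 * l)) (by repeat' (first | exact lin_id | apply And.intro | intro _ | apply lin_tl | apply lin_tr | apply lin_ml | apply lin_mr | apply lin_app2 | apply lin_app | apply lin_Sr | apply lin_Sl))]
        refine S_congr fun g1 g2 => ?_
        rw [ma_S α hma]
        have e : a * S (Δ g1) (fun x y => α x b * α y (α h1 c)) =
          S (Δ g1) (fun x y => a * (α x b * α y (α h1 c))) := map_S (LinearMap.mul k B a) _ _
        rw [e, S_tm]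
        simp only [hα_mul, mul_assoc]

theorem one_mul_aux (hα_one : ∀ b : B, α 1 b = b) (b : B) (h : H) :
    smashMul k α (((1 : B) ⊗ₜ[k] (1 : H)) ⊗ₜ[k] (b ⊗ₜ[k] h)) = b ⊗ₜ[k] h := by
  rw [smashMul_S, Bialgebra.comul_one, Algebra.TensorProduct.one_def, S_tmul (by repeat' (first | exact lin_id | apply And.intro | intro _ | apply lin_tl | apply lin_tr | apply lin_ml | apply lin_mr | apply lin_app2 | apply lin_app | apply lin_Sr | apply lin_Sl))]
  simp only [one_mul, hα_one]

theorem mul_one_aux (hma1 : ∀ h : H, α h (1 : B) = Coalgebra.counit (R := k) h • (1 : B))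
    (b : B) (h : H) :
    smashMul k α ((b ⊗ₜ[k] h) ⊗ₜ[k] ((1 : B) ⊗ₜ[k] (1 : H))) = b ⊗ₜ[k] h := by
  rw [smashMul_S]
  conv_rhs => rw [← counit_S (k := k) h]
  rw [tm_S]
  simp only [hma1, mul_one, mul_smul_comm, TensorProduct.smul_tmul]

theorem coassoc_aux (hρ_coassoc : ComodCoassoc ρ)
    (hcc : ComodCoalg ρ)
    (b : B) (h : H) :
    TensorProduct.assoc k (B ⊗[k] H) (B ⊗[k] H) (B ⊗[k] H)
        (TensorProduct.map (smashComul k ρ) LinearMap.id (smashComul k ρ (b ⊗ₜ[k] h)))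
      = TensorProduct.map LinearMap.id (smashComul k ρ) (smashComul k ρ (b ⊗ₜ[k] h)) := by
  simp only [smashComul_S, map_S, mapE_S, TensorProduct.map_tmul, LinearMap.id_apply, S_tm, tm_S,
    TensorProduct.assoc_tmul]
  -- normal form
  have key : ∀ b1 b2 b3 : B, 
     S (ρ b2) (fun r s => S (ρ b3) (fun u v => S (Δ h) (fun h1 h2 => S (Δ (u * h1)) (fun x y =>
      (b1 ⊗ₜ[k] (r * x)) ⊗ₜ[k] ((s ⊗ₜ[k] y) ⊗ₜ[k] (v ⊗ₜ[k] h2)))))) =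
     S (ρ b2) (fun r s => S (ρ b3) (fun u v => S (ρ v) (fun p q => S (Δ h) (fun h1 h2 => 
      S (Δ h2) (fun x y =>
      (b1 ⊗ₜ[k] (r * u * h1)) ⊗ₜ[k] ((s ⊗ₜ[k] (p * x)) ⊗ₜ[k] (q ⊗ₜ[k] y))))))) := by
    intro b1 b2 b3
    refine S_congr fun r s => ?_
    rw [← rcoassoc_S ρ hρ_coassoc (f := fun u p q => S (Δ h) (fun h1 h2 => S (Δ h2) (fun x y =>
      (b1 ⊗ₜ[k] (r * u * h1)) ⊗ₜ[k] ((s ⊗ₜ[k] (p * x)) ⊗ₜ[k] (q ⊗ₜ[k] y))))) (by repeat' (first | exact lin_id | apply And.intro | intro _ | apply lin_tl | apply lin_tr | apply lin_ml | apply lin_mr | apply lin_app2 | apply lin_app | apply lin_Sr | apply lin_Sl))]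
    refine S_congr fun u v => ?_
    rw [S_swap]
    calc _ = S (Δ h) (fun h1 h2 => S (Δ h1) (fun h11 h12 => S (Δ u) (fun u1 u2 => 
          (b1 ⊗ₜ[k] (r * u1 * h11)) ⊗ₜ[k] ((s ⊗ₜ[k] (u2 * h12)) ⊗ₜ[k] (v ⊗ₜ[k] h2))))) := by
            refine S_congr fun h1 h2 => ?_
            rw [comul_mul_S (by repeat' (first | exact lin_id | apply And.intro | intro _ | apply lin_tl | apply lin_tr | apply lin_ml | apply lin_mr | apply lin_app2 | apply lin_app | apply lin_Sr | apply lin_Sl)), S_swap]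
            simp only [mul_assoc]
      _ = _ := by
            rw [coassoc_S (f := fun h11 h12 h2 => S (Δ u) (fun u1 u2 => 
              (b1 ⊗ₜ[k] (r * u1 * h11)) ⊗ₜ[k] ((s ⊗ₜ[k] (u2 * h12)) ⊗ₜ[k] (v ⊗ₜ[k] h2)))) (by repeat' (first | exact lin_id | apply And.intro | intro _ | apply lin_tl | apply lin_tr | apply lin_ml | apply lin_mr | apply lin_app2 | apply lin_app | apply lin_Sr | apply lin_Sl))]
            refine S_congr fun h1 h2 => ?_
            rw [S_swap]
  calc _ = S (Δ b) (fun b1 b2 => S (Δ b1) (fun x y => S (ρ y) (fun r s => S (ρ b2) (fun u v =>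
      S (Δ h) (fun h1 h2 => S (Δ (u * h1)) (fun p q =>
        (x ⊗ₜ[k] (r * p)) ⊗ₜ[k] ((s ⊗ₜ[k] q) ⊗ₜ[k] (v ⊗ₜ[k] h2)))))))) := by
        refine S_congr fun b1 b2 => ?_
        refine (S_pull fun _ _ => S_pull fun _ _ => rfl).trans ?_
        refine S_congr fun x y => ?_
        exact S_pull fun _ _ => S_pull fun _ _ => rfl
    _ = _ := by
        simp only [key]
        rw [coassoc_S (f := fun b1 b2 b3 => S (ρ b2) (fun r s => S (ρ b3) (fun u v =>
          S (ρ v) (fun p q => S (Δ h) (fun h1 h2 => S (Δ h2) (fun x y =>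
          (b1 ⊗ₜ[k] (r * u * h1)) ⊗ₜ[k] ((s ⊗ₜ[k] (p * x)) ⊗ₜ[k] (q ⊗ₜ[k] y)))))))) (by repeat' (first | exact lin_id | apply And.intro | intro _ | apply lin_tl | apply lin_tr | apply lin_ml | apply lin_mr | apply lin_app2 | apply lin_app | apply lin_Sr | apply lin_Sl))]
        refine S_congr fun b1 b2 => ?_
        rw [← cc_S ρ hcc (f := fun w s v => S (ρ v) (fun p q => S (Δ h) (fun h1 h2 =>
          S (Δ h2) (fun x y =>
          (b1 ⊗ₜ[k] (w * h1)) ⊗ₜ[k] ((s ⊗ₜ[k] (p * x)) ⊗ₜ[k] (q ⊗ₜ[k] y)))))) (by repeat' (first | exact lin_id | apply And.intro | intro _ | apply lin_tl | apply lin_tr | apply lin_ml | apply lin_mr | apply lin_app2 | apply lin_app | apply lin_Sr | apply lin_Sl))]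
        refine S_congr fun u v => ?_
        conv_rhs => rw [S_swap]
        refine S_congr fun x y => ?_
        rw [S_swap]

theorem counitl_aux (hρ_counit : ComodCounital ρ)
    (b : B) (h : H) :
    TensorProduct.lid k (B ⊗[k] H)
        (TensorProduct.map (smashCounit k) LinearMap.id (smashComul k ρ (b ⊗ₜ[k] h)))
      = b ⊗ₜ[k] h := by
  simp only [smashComul_S, map_S, mapE_S, TensorProduct.map_tmul, LinearMap.id_apply,
    TensorProduct.lid_tmul, smashCounit, LinearMap.comp_apply, LinearMap.mul'_apply,
    Bialgebra.counit_mul]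
  conv_rhs => rw [← counit_S (k := k) b, S_tm]
  refine S_congr fun b1 b2 => ?_
  conv_rhs => rw [← rcounit_S ρ hρ_counit b2, smul_S, S_tm]
  refine S_congr fun u v => ?_
  conv_rhs => rw [← counit_S (k := k) h, tm_S]
  refine S_congr fun h1 h2 => ?_
  simp only [TensorProduct.tmul_smul, ← TensorProduct.smul_tmul', smul_smul]
  congr 1
  ring

theorem counitr_aux (hccε : ComodCounit ρ)
    (b : B) (h : H) :
    TensorProduct.rid k (B ⊗[k] H)
        (TensorProduct.map LinearMap.id (smashCounit k) (smashComul k ρ (b ⊗ₜ[k] h)))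
      = b ⊗ₜ[k] h := by
  simp only [smashComul_S, map_S, mapE_S, TensorProduct.map_tmul, LinearMap.id_apply,
    TensorProduct.rid_tmul, smashCounit, LinearMap.comp_apply, LinearMap.mul'_apply]
  conv_rhs => rw [← counit_S' (k := k) b, S_tm]
  refine S_congr fun b1 b2 => ?_
  have e : (ε b2 • b1) ⊗ₜ[k] h = b1 ⊗ₜ[k] ((ε b2 • (1 : H)) * h) := by
    rw [smul_mul_assoc, one_mul, TensorProduct.smul_tmul]
  rw [e, ← ccε_S ρ hccε, S_mul, tm_S]
  refine S_congr fun u v => ?_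
  conv_rhs => rw [← counit_S' (k := k) h]
  have e2 : (ε v • u) * S (Δ h) (fun c1 c2 => ε c2 • c1) =
      S (Δ h) (fun c1 c2 => (ε v • u) * (ε c2 • c1)) :=
    map_S (LinearMap.mul k H (ε v • u)) _ _
  rw [e2, tm_S]
  refine S_congr fun h1 h2 => ?_
  simp only [TensorProduct.tmul_smul, smul_mul_assoc, mul_smul_comm, smul_smul]
  rw [mul_comm]

theorem g_aux  (hYD : YetterDrinfeld α ρ)
    (b b1 c d : B) (w w1 w2 w3 : H) (g : H) :
    S (Δ g) (fun g1 g2 => S (Δ g1) (fun g11 g12 => S (ρ (α g12 b)) (fun r s =>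
      S (Δ g2) (fun g21 g22 => ((c * α w (α g11 b1)) ⊗ₜ[k] (w1 * ((r * g21) * w2))) ⊗ₜ[k] 
        ((d * s) ⊗ₜ[k] (g22 * w3)))))) = 
    S (Δ g) (fun g1 g2 => S (Δ g1) (fun g11 g12 => S (Δ g2) (fun g21 g22 => S (ρ b) (fun r s =>
      ((c * α w (α g11 b1)) ⊗ₜ[k] (w1 * ((g12 * r) * w2))) ⊗ₜ[k] 
        ((d * α g21 s) ⊗ₜ[k] (g22 * w3)))))) := by
  rw [coassoc_S (f := fun x y z => S (ρ (α y b)) (fun r s =>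
      S (Δ z) (fun g21 g22 => ((c * α w (α x b1)) ⊗ₜ[k] (w1 * ((r * g21) * w2))) ⊗ₜ[k] 
        ((d * s) ⊗ₜ[k] (g22 * w3))))) (by repeat' (first | exact lin_id | apply And.intro | intro _ | apply lin_tl | apply lin_tr | apply lin_ml | apply lin_mr | apply lin_app2 | apply lin_app | apply lin_Sr | apply lin_Sl))]
  rw [coassoc_S (f := fun x y z => S (Δ z) (fun g21 g22 => S (ρ b) (fun r s =>
      ((c * α w (α x b1)) ⊗ₜ[k] (w1 * ((y * r) * w2))) ⊗ₜ[k] 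
        ((d * α g21 s) ⊗ₜ[k] (g22 * w3))))) (by repeat' (first | exact lin_id | apply And.intro | intro _ | apply lin_tl | apply lin_tr | apply lin_ml | apply lin_mr | apply lin_app2 | apply lin_app | apply lin_Sr | apply lin_Sl))]
  refine S_congr fun x g' => ?_
  rw [← coassoc_S (f := fun y z t => S (ρ b) (fun r s =>
      ((c * α w (α x b1)) ⊗ₜ[k] (w1 * ((y * r) * w2))) ⊗ₜ[k] 
        ((d * α z s) ⊗ₜ[k] (t * w3)))) (by repeat' (first | exact lin_id | apply And.intro | intro _ | apply lin_tl | apply lin_tr | apply lin_ml | apply lin_mr | apply lin_app2 | apply lin_app | apply lin_Sr | apply lin_Sl))]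
  calc _ = S (Δ g') (fun p q => S (Δ q) (fun g21 g22 => S (ρ (α p b)) (fun r s =>
        ((c * α w (α x b1)) ⊗ₜ[k] (w1 * ((r * g21) * w2))) ⊗ₜ[k] 
        ((d * s) ⊗ₜ[k] (g22 * w3))))) := S_congr fun p q => by rw [S_swap]
    _ = _ := by
      rw [← coassoc_S (f := fun p y z => S (ρ (α p b)) (fun r s =>
        ((c * α w (α x b1)) ⊗ₜ[k] (w1 * ((r * y) * w2))) ⊗ₜ[k] 
        ((d * s) ⊗ₜ[k] (z * w3)))) (by repeat' (first | exact lin_id | apply And.intro | intro _ | apply lin_tl | apply lin_tr | apply lin_ml | apply lin_mr | apply lin_app2 | apply lin_app | apply lin_Sr | apply lin_Sl))]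
      refine S_congr fun p q => ?_
      exact YD_S α ρ hYD (f := fun y s => ((c * α w (α x b1)) ⊗ₜ[k] (w1 * (y * w2))) ⊗ₜ[k] 
        ((d * s) ⊗ₜ[k] (q * w3))) (by repeat' (first | exact lin_id | apply And.intro | intro _ | apply lin_tl | apply lin_tr | apply lin_ml | apply lin_mr | apply lin_app2 | apply lin_app | apply lin_Sr | apply lin_Sl)) p b

theorem comul_mul_aux 
    (hα_mul : ∀ (g h : H) (b : B), α (g * h) b = α g (α h b))
    (hmc : ModCoalg α)
    (hρ_coassoc : ComodCoassoc ρ)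
    (hca : ComodAlg ρ)
    (htw : Twisted α ρ)
    (hYD : YetterDrinfeld α ρ)
    (a b : B) (g h : H) :
    smashComul k ρ (smashMul k α ((a ⊗ₜ[k] g) ⊗ₜ[k] (b ⊗ₜ[k] h)))
        = (TensorProduct.map (smashMul k α) (smashMul k α))
            ((TensorProduct.tensorTensorTensorComm k
                (B ⊗[k] H) (B ⊗[k] H) (B ⊗[k] H) (B ⊗[k] H))
              (smashComul k ρ (a ⊗ₜ[k] g) ⊗ₜ[k] smashComul k ρ (b ⊗ₜ[k] h))) := by
  simp only [smashMul_S, smashComul_S, map_S, mapE_S, TensorProduct.map_tmul, S_tm, tm_S,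
    TensorProduct.tensorTensorTensorComm_tmul]
  calc _ = S (Δ g) (fun g1 g2 => S (Δ a) (fun a1 a2 => S (ρ a2) (fun u v => 
        S (Δ (α g1 b)) (fun y1 y2 => S (ρ (v * y2)) (fun p q => S (Δ (g2 * h)) (fun z1 z2 =>
        ((a1 * α u y1) ⊗ₜ[k] (p * z1)) ⊗ₜ[k] (q ⊗ₜ[k] z2))))))) := by
          refine S_congr fun g1 g2 => ?_
          rw [tw_S α ρ htw (by repeat' (first | exact lin_id | apply And.intro | intro _ | apply lin_tl | apply lin_tr | apply lin_ml | apply lin_mr | apply lin_app2 | apply lin_app | apply lin_Sr | apply lin_Sl))]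
    _ = S (Δ a) (fun a1 a2 => S (ρ a2) (fun u v => S (Δ g) (fun g1 g2 => 
        S (Δ (α g1 b)) (fun y1 y2 => S (ρ (v * y2)) (fun p q => S (Δ (g2 * h)) (fun z1 z2 =>
        ((a1 * α u y1) ⊗ₜ[k] (p * z1)) ⊗ₜ[k] (q ⊗ₜ[k] z2))))))) := by
          rw [S_swap]
          refine S_congr fun a1 a2 => ?_
          rw [S_swap]
    _ = S (Δ a) (fun a1 a2 => S (ρ a2) (fun u v => S (Δ g) (fun g1 g2 => S (Δ g1) (fun g11 g12 =>
        S (Δ b) (fun b1 b2 => S (ρ v) (fun p q => S (ρ (α g12 b2)) (fun r s => 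
        S (Δ g2) (fun g21 g22 => S (Δ h) (fun h1 h2 =>
        ((a1 * α u (α g11 b1)) ⊗ₜ[k] (p * ((r * g21) * h1))) ⊗ₜ[k]
          ((q * s) ⊗ₜ[k] (g22 * h2))))))))))) := by
          refine S_congr fun a1 a2 => S_congr fun u v => S_congr fun g1 g2 => ?_
          rw [mc_S α hmc (by repeat' (first | exact lin_id | apply And.intro | intro _ | apply lin_tl | apply lin_tr | apply lin_ml | apply lin_mr | apply lin_app2 | apply lin_app | apply lin_Sr | apply lin_Sl))]
          refine S_congr fun g11 g12 => S_congr fun b1 b2 => ?_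
          rw [ca_S ρ hca (by repeat' (first | exact lin_id | apply And.intro | intro _ | apply lin_tl | apply lin_tr | apply lin_ml | apply lin_mr | apply lin_app2 | apply lin_app | apply lin_Sr | apply lin_Sl))]
          refine S_congr fun p q => S_congr fun r s => ?_
          rw [comul_mul_S (by repeat' (first | exact lin_id | apply And.intro | intro _ | apply lin_tl | apply lin_tr | apply lin_ml | apply lin_mr | apply lin_app2 | apply lin_app | apply lin_Sr | apply lin_Sl))]
          simp only [mul_assoc]
    _ = S (Δ a) (fun a1 a2 => S (ρ a2) (fun u v => S (ρ v) (fun p q => S (Δ b) (fun b1 b2 =>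
        S (Δ h) (fun h1 h2 => S (Δ g) (fun g1 g2 => S (Δ g1) (fun g11 g12 =>
        S (ρ (α g12 b2)) (fun r s => S (Δ g2) (fun g21 g22 => 
        ((a1 * α u (α g11 b1)) ⊗ₜ[k] (p * ((r * g21) * h1))) ⊗ₜ[k]
          ((q * s) ⊗ₜ[k] (g22 * h2))))))))))) := by
          refine S_congr fun a1 a2 => S_congr fun u v => ?_
          refine (S_pull fun _ _ => S_pull fun _ _ => S_pull fun _ _ => rfl).trans ?_
          refine S_congr fun p q => ?_
          refine (S_pull fun _ _ => S_pull fun _ _ => rfl).trans ?_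
          refine S_congr fun b1 b2 => ?_
          exact S_pull fun _ _ => S_pull fun _ _ => S_pull fun _ _ => S_pull fun _ _ => rfl
    _ = S (Δ a) (fun a1 a2 => S (ρ a2) (fun u v => S (ρ v) (fun p q => S (Δ b) (fun b1 b2 =>
        S (Δ h) (fun h1 h2 => S (Δ g) (fun g1 g2 => S (Δ g1) (fun g11 g12 =>
        S (Δ g2) (fun g21 g22 => S (ρ b2) (fun r s =>
        ((a1 * α u (α g11 b1)) ⊗ₜ[k] (p * ((g12 * r) * h1))) ⊗ₜ[k]
          ((q * α g21 s) ⊗ₜ[k] (g22 * h2))))))))))) := by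
          refine S_congr fun a1 a2 => S_congr fun u v => S_congr fun p q => S_congr fun b1 b2 =>
            S_congr fun h1 h2 => ?_
          exact g_aux α ρ hYD _ _ _ _ _ _ _ _ _
    _ = S (Δ a) (fun a1 a2 => S (ρ a2) (fun u v => S (Δ u) (fun u1 u2 => S (Δ b) (fun b1 b2 =>
        S (Δ h) (fun h1 h2 => S (Δ g) (fun g1 g2 => S (Δ g1) (fun g11 g12 =>
        S (Δ g2) (fun g21 g22 => S (ρ b2) (fun r s =>
        ((a1 * α u1 (α g11 b1)) ⊗ₜ[k] (u2 * ((g12 * r) * h1))) ⊗ₜ[k]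
          ((v * α g21 s) ⊗ₜ[k] (g22 * h2))))))))))) := by
          refine S_congr fun a1 a2 => ?_
          exact (rcoassoc_S ρ hρ_coassoc (f := fun u p q => S (Δ b) (fun b1 b2 =>
            S (Δ h) (fun h1 h2 => S (Δ g) (fun g1 g2 => S (Δ g1) (fun g11 g12 =>
            S (Δ g2) (fun g21 g22 => S (ρ b2) (fun r s =>
            ((a1 * α u (α g11 b1)) ⊗ₜ[k] (p * ((g12 * r) * h1))) ⊗ₜ[k]
            ((q * α g21 s) ⊗ₜ[k] (g22 * h2))))))))) (by repeat' (first | exact lin_id | apply And.intro | intro _ | apply lin_tl | apply lin_tr | apply lin_ml | apply lin_mr | apply lin_app2 | apply lin_app | apply lin_Sr | apply lin_Sl)) a2).symm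
    _ = _ := by
          symm
          refine (S_pull fun _ _ => S_pull fun _ _ => S_pull fun _ _ => rfl).trans ?_
          refine S_congr fun a1 a2 => ?_
          refine (S_pull fun _ _ => S_pull fun _ _ => S_pull fun _ _ => rfl).trans ?_
          refine S_congr fun u v => ?_
          refine (S_pull fun _ _ => S_pull fun _ _ => S_pull fun _ _ => S_pull fun _ _ =>
            S_pull fun _ _ => comul_mul_S (by repeat' (first | exact lin_id | apply And.intro | intro _ | apply lin_tl | apply lin_tr | apply lin_ml | apply lin_mr | apply lin_app2 | apply lin_app | apply lin_Sr | apply lin_Sl)) _ _).trans ?_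
          refine S_congr fun u1 u2 => S_congr fun b1 b2 => ?_
          refine (S_pull fun _ _ => rfl).trans ?_
          refine S_congr fun h1 h2 => ?_
          refine (S_pull fun _ _ => rfl).trans ?_
          refine S_congr fun g1 g2 => ?_
          refine (S_pull fun _ _ => S_pull fun _ _ => rfl).trans ?_
          refine S_congr fun g11 g12 => ?_
          refine (S_pull fun _ _ => rfl).trans ?_
          refine S_congr fun g21 g22 => S_congr fun r s => ?_
          simp only [hα_mul, mul_assoc]

theorem counit_mul_aux
    (hmcε : ∀ (h : H) (b : B),
      Coalgebra.counit (R := k) (α h b)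
        = Coalgebra.counit (R := k) h * Coalgebra.counit (R := k) b)
    (hεB_mul : ∀ a b : B,
      Coalgebra.counit (R := k) (a * b)
        = Coalgebra.counit (R := k) a * Coalgebra.counit (R := k) b)
    (a b : B) (g h : H) :
    smashCounit k (smashMul k α ((a ⊗ₜ[k] g) ⊗ₜ[k] (b ⊗ₜ[k] h))) =
      smashCounit k (a ⊗ₜ[k] g) * smashCounit k (b ⊗ₜ[k] h) := by
  simp only [smashMul_S, map_S, smashCounit, LinearMap.comp_apply, TensorProduct.map_tmul,
    LinearMap.mul'_apply, hεB_mul, hmcε, Bialgebra.counit_mul]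
  have e := congrArg (fun t => ε a * ε b * ε h * ε t) (counit_S (k := k) g)
  simp only [map_S, map_smul, smul_eq_mul] at e
  have e2 := map_S (LinearMap.mul k k (ε a * ε b * ε h)) (Δ g) (fun u v => ε u * ε v)
  simp only [LinearMap.mul_apply'] at e2
  rw [e2] at e
  calc _ = _ := S_congr fun u v => by ring
    _ = _ := e
    _ = _ := by ring

end

end RadfordAux

/-- Radford's biproduct theorem, bialgebra part: under all the
compatibility hypotheses, the smash product multiplication and smash coproduct
comultiplication make `B ⋆ H = B ⊗ H` into a bialgebra. -/
theorem radford_biproduct_bialgebra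
    (k H B : Type*) [Field k] [Semiring H] [Bialgebra k H]
    [Ring B] [Algebra k B] [Coalgebra k B]
    (α : H →ₗ[k] B →ₗ[k] B) (ρ : B →ₗ[k] H ⊗[k] B)
    -- `B` is a left `H`-module
    (hα_one : ∀ b : B, α 1 b = b)
    (hα_mul : ∀ (g h : H) (b : B), α (g * h) b = α g (α h b))
    -- `B` is a left `H`-module algebra
    (hma : ∀ (h : H) (a b : B),
      α h (a * b) =
        LinearMap.mul' k B (TensorProduct.map (α.flip a) (α.flip b) (Coalgebra.comul h)))
    (hma1 : ∀ h : H, α h (1 : B) = Coalgebra.counit (R := k) h • (1 : B))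
    -- `B` is a left `H`-module coalgebra
    (hmc : ∀ (h : H) (b : B),
      Coalgebra.comul (R := k) (α h b) =
        (TensorProduct.map (TensorProduct.lift α) (TensorProduct.lift α))
          ((TensorProduct.tensorTensorTensorComm k H H B B)
            (Coalgebra.comul h ⊗ₜ[k] Coalgebra.comul b)))
    (hmcε : ∀ (h : H) (b : B),
      Coalgebra.counit (R := k) (α h b)
        = Coalgebra.counit (R := k) h * Coalgebra.counit (R := k) b)
    -- `B` is a left `H`-comodule
    (hρ_coassoc : (TensorProduct.assoc k H H B).toLinearMap
        ∘ₗ (TensorProduct.map Coalgebra.comul LinearMap.id) ∘ₗ ρ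
      = (TensorProduct.map LinearMap.id ρ) ∘ₗ ρ)
    (hρ_counit : (TensorProduct.lid k B).toLinearMap
        ∘ₗ (TensorProduct.map Coalgebra.counit LinearMap.id) ∘ₗ ρ = LinearMap.id)
    -- `B` is a left `H`-comodule algebra
    (hca : ∀ a b : B,
      ρ (a * b) = (TensorProduct.map (LinearMap.mul' k H) (LinearMap.mul' k B))
        ((TensorProduct.tensorTensorTensorComm k H B H B) (ρ a ⊗ₜ[k] ρ b)))
    (hca1 : ρ (1 : B) = (1 : H) ⊗ₜ[k] (1 : B))
    -- `B` is a left `H`-comodule coalgebra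
    (hcc : ∀ b : B,
      (TensorProduct.map LinearMap.id Coalgebra.comul) (ρ b)
        = (TensorProduct.map (LinearMap.mul' k H) LinearMap.id)
            ((TensorProduct.tensorTensorTensorComm k H B H B)
              ((TensorProduct.map ρ ρ) (Coalgebra.comul b))))
    (hccε : ∀ b : B,
      (TensorProduct.rid k H) ((TensorProduct.map LinearMap.id Coalgebra.counit) (ρ b))
        = Coalgebra.counit (R := k) b • (1 : H))
    -- `ε_B` is an algebra map
    (hεB_mul : ∀ a b : B,
      Coalgebra.counit (R := k) (a * b)
        = Coalgebra.counit (R := k) a * Coalgebra.counit (R := k) b)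
    (hεB_one : Coalgebra.counit (R := k) (1 : B) = 1)
    -- `Δ_B 1 = 1 ⊗ 1`
    (hΔ1 : Coalgebra.comul (R := k) (1 : B) = (1 : B) ⊗ₜ[k] (1 : B))
    -- the twisted comultiplication condition (1) of Radford's theorem:
    -- `Δ_B(ab) = Σ a₁ ((a₂)₍₋₁₎ · b₁) ⊗ (a₂)₍₀₎ b₂`
    (htw : ∀ a b : B,
      Coalgebra.comul (R := k) (a * b) =
        (TensorProduct.map
            ((LinearMap.mul' k B)
              ∘ₗ (TensorProduct.map LinearMap.id (TensorProduct.lift α))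
              ∘ₗ (TensorProduct.assoc k B H B).toLinearMap)
            (LinearMap.mul' k B))
          ((TensorProduct.tensorTensorTensorComm k (B ⊗[k] H) B B B)
            ((TensorProduct.map
                ((TensorProduct.assoc k B H B).symm.toLinearMap
                  ∘ₗ (TensorProduct.map LinearMap.id ρ))
                LinearMap.id)
              (Coalgebra.comul a ⊗ₜ[k] Coalgebra.comul b))))
    -- the Yetter–Drinfeld condition (2) of Radford's theorem:
    -- `Σ h₁ b₍₋₁₎ ⊗ h₂ · b₍₀₎ = Σ (h₁·b)₍₋₁₎ h₂ ⊗ (h₁·b)₍₀₎`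
    (hYD : ∀ (h : H) (b : B),
      (TensorProduct.map (LinearMap.mul' k H) (TensorProduct.lift α))
          ((TensorProduct.tensorTensorTensorComm k H H H B)
            (Coalgebra.comul h ⊗ₜ[k] ρ b))
        = ((TensorProduct.map (LinearMap.mul' k H) LinearMap.id)
            ∘ₗ (TensorProduct.assoc k H H B).symm.toLinearMap
            ∘ₗ (TensorProduct.map LinearMap.id (TensorProduct.comm k B H).toLinearMap)
            ∘ₗ (TensorProduct.assoc k H B H).toLinearMap
            ∘ₗ (TensorProduct.map (ρ ∘ₗ α.flip b) LinearMap.id))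
          (Coalgebra.comul h))
    :
    -- `B ⋆ H` is an associative unital algebra
    (smashMul k α ∘ₗ TensorProduct.map (smashMul k α) LinearMap.id
      = smashMul k α ∘ₗ TensorProduct.map LinearMap.id (smashMul k α)
          ∘ₗ (TensorProduct.assoc k (B ⊗[k] H) (B ⊗[k] H) (B ⊗[k] H)).toLinearMap) ∧
    (∀ x : B ⊗[k] H,
      smashMul k α ((((1 : B) ⊗ₜ[k] (1 : H))) ⊗ₜ[k] x) = x ∧
      smashMul k α (x ⊗ₜ[k] ((1 : B) ⊗ₜ[k] (1 : H))) = x) ∧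
    -- `B ⋆ H` is a coassociative counital coalgebra
    ((TensorProduct.assoc k (B ⊗[k] H) (B ⊗[k] H) (B ⊗[k] H)).toLinearMap
        ∘ₗ (TensorProduct.map (smashComul k ρ) LinearMap.id) ∘ₗ smashComul k ρ
      = (TensorProduct.map LinearMap.id (smashComul k ρ)) ∘ₗ smashComul k ρ) ∧
    ((TensorProduct.lid k (B ⊗[k] H)).toLinearMap
        ∘ₗ (TensorProduct.map (smashCounit k) LinearMap.id) ∘ₗ smashComul k ρ
      = LinearMap.id) ∧
    ((TensorProduct.rid k (B ⊗[k] H)).toLinearMap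
        ∘ₗ (TensorProduct.map LinearMap.id (smashCounit k)) ∘ₗ smashComul k ρ
      = LinearMap.id) ∧
    -- the comultiplication is an algebra map
    (∀ x y : B ⊗[k] H,
      smashComul k ρ (smashMul k α (x ⊗ₜ[k] y))
        = (TensorProduct.map (smashMul k α) (smashMul k α))
            ((TensorProduct.tensorTensorTensorComm k
                (B ⊗[k] H) (B ⊗[k] H) (B ⊗[k] H) (B ⊗[k] H))
              (smashComul k ρ x ⊗ₜ[k] smashComul k ρ y))) ∧
    (smashComul k ρ ((1 : B) ⊗ₜ[k] (1 : H))
      = ((1 : B) ⊗ₜ[k] (1 : H)) ⊗ₜ[k] ((1 : B) ⊗ₜ[k] (1 : H))) ∧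
    -- the counit is an algebra map
    (∀ x y : B ⊗[k] H,
      smashCounit k (smashMul k α (x ⊗ₜ[k] y)) = smashCounit k x * smashCounit k y) ∧
    (smashCounit k ((1 : B) ⊗ₜ[k] (1 : H)) = 1) := by
  refine ⟨?_, ?_, ?_, ?_, ?_, ?_, ?_, ?_, ?_⟩
  · ext a g b h c l
    exact RadfordAux.mul_assoc_aux α hα_mul hma a b c g h l
  · intro x
    constructor
    · induction x with
      | zero => simp
      | tmul b h => exact RadfordAux.one_mul_aux α hα_one b h
      | add x y hx hy => rw [TensorProduct.tmul_add, map_add, hx, hy]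
    · induction x with
      | zero => simp
      | tmul b h => exact RadfordAux.mul_one_aux α hma1 b h
      | add x y hx hy => rw [TensorProduct.add_tmul, map_add, hx, hy]
  · refine TensorProduct.ext' fun b h => ?_
    exact RadfordAux.coassoc_aux ρ hρ_coassoc hcc b h
  · refine TensorProduct.ext' fun b h => ?_
    exact RadfordAux.counitl_aux ρ hρ_counit b h
  · refine TensorProduct.ext' fun b h => ?_
    exact RadfordAux.counitr_aux ρ hccε b h
  · intro x y
    induction x with
    | zero => simp
    | tmul a g =>
      induction y with
      | zero => simp
      | tmul b h => exact RadfordAux.comul_mul_aux α ρ hα_mul hmc hρ_coassoc hca htw hYD a b g h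
      | add x y hx hy => simp only [TensorProduct.tmul_add, map_add, hx, hy]
    | add x y hx hy => simp only [TensorProduct.add_tmul, map_add, hx, hy]
  · rw [RadfordAux.smashComul_S, hΔ1, RadfordAux.S_tmul (by repeat' (first | exact RadfordAux.lin_id | apply And.intro | intro _ | apply RadfordAux.lin_tl | apply RadfordAux.lin_tr | apply RadfordAux.lin_ml | apply RadfordAux.lin_mr | apply RadfordAux.lin_app2 | apply RadfordAux.lin_app | apply RadfordAux.lin_Sr | apply RadfordAux.lin_Sl)), hca1,
      RadfordAux.S_tmul (by repeat' (first | exact RadfordAux.lin_id | apply And.intro | intro _ | apply RadfordAux.lin_tl | apply RadfordAux.lin_tr | apply RadfordAux.lin_ml | apply RadfordAux.lin_mr | apply RadfordAux.lin_app2 | apply RadfordAux.lin_app | apply RadfordAux.lin_Sr | apply RadfordAux.lin_Sl)), Bialgebra.comul_one, Algebra.TensorProduct.one_def,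
      RadfordAux.S_tmul (by repeat' (first | exact RadfordAux.lin_id | apply And.intro | intro _ | apply RadfordAux.lin_tl | apply RadfordAux.lin_tr | apply RadfordAux.lin_ml | apply RadfordAux.lin_mr | apply RadfordAux.lin_app2 | apply RadfordAux.lin_app | apply RadfordAux.lin_Sr | apply RadfordAux.lin_Sl))]
    simp only [one_mul]
  · intro x y
    induction x with
    | zero => simp
    | tmul a g =>
      induction y with
      | zero => simp
      | tmul b h => exact RadfordAux.counit_mul_aux α hmcε hεB_mul a b g h
      | add x y hx hy => simp only [TensorProduct.tmul_add, map_add, hx, hy, mul_add]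
    | add x y hx hy => simp only [TensorProduct.add_tmul, map_add, hx, hy, add_mul]
  · simp [smashCounit, hεB_one]
end
end

section
/- Under the biproduct hypotheses, the comultiplication Δ of B ⋆ H is multiplicative: Δ((a⋆g)(b⋆h)) = Δ(a⋆g)Δ(b⋆h) for all a,b in B and g,h in H. -/
open TensorProduct

noncomputable section

section Helpers

variable {k H B : Type*} [Field k] [Semiring H] [Bialgebra k H]
    [Ring B] [Algebra k B]

/-- The tail of `smashComul`, to be applied to `Δ b ⊗ Δ h`. -/
def auxS (ρ : B →ₗ[k] H ⊗[k] B) :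
    ((B ⊗[k] B) ⊗[k] (H ⊗[k] H)) →ₗ[k] ((B ⊗[k] H) ⊗[k] (B ⊗[k] H)) :=
  (TensorProduct.map
      ((TensorProduct.map LinearMap.id (LinearMap.mul' k H))
        ∘ₗ (TensorProduct.assoc k B H H).toLinearMap)
      LinearMap.id)
  ∘ₗ (TensorProduct.tensorTensorTensorComm k (B ⊗[k] H) B H H).toLinearMap
  ∘ₗ (TensorProduct.map
        ((TensorProduct.assoc k B H B).symm.toLinearMap
          ∘ₗ (TensorProduct.map LinearMap.id ρ))
        LinearMap.id)

/-- The twisted multiplication on `B ⊗ B`. -/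
def auxTW (α : H →ₗ[k] B →ₗ[k] B) (ρ : B →ₗ[k] H ⊗[k] B) :
    ((B ⊗[k] B) ⊗[k] (B ⊗[k] B)) →ₗ[k] (B ⊗[k] B) :=
  (TensorProduct.map
            ((LinearMap.mul' k B)
              ∘ₗ (TensorProduct.map LinearMap.id (TensorProduct.lift α))
              ∘ₗ (TensorProduct.assoc k B H B).toLinearMap)
            (LinearMap.mul' k B))
          ∘ₗ (TensorProduct.tensorTensorTensorComm k (B ⊗[k] H) B B B).toLinearMap
          ∘ₗ (TensorProduct.map
                ((TensorProduct.assoc k B H B).symm.toLinearMap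
                  ∘ₗ (TensorProduct.map LinearMap.id ρ))
                LinearMap.id)

/-- The diagonal action of `H ⊗ H` on `B ⊗ B`. -/
def auxMC (α : H →ₗ[k] B →ₗ[k] B) :
    ((H ⊗[k] H) ⊗[k] (B ⊗[k] B)) →ₗ[k] (B ⊗[k] B) :=
  (TensorProduct.map (TensorProduct.lift α) (TensorProduct.lift α))
    ∘ₗ (TensorProduct.tensorTensorTensorComm k H H B B).toLinearMap

/-- `p ⊗ q ↦ p b₍₋₁₎ ⊗ q · b₍₀₎`. -/
def auxYR (α : H →ₗ[k] B →ₗ[k] B) (t : H ⊗[k] B) :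
    (H ⊗[k] H) →ₗ[k] (H ⊗[k] B) :=
  (TensorProduct.map (LinearMap.mul' k H) (TensorProduct.lift α))
    ∘ₗ (TensorProduct.tensorTensorTensorComm k H H H B).toLinearMap
    ∘ₗ ((TensorProduct.mk k (H ⊗[k] H) (H ⊗[k] B)).flip t)

theorem auxYR_add (α : H →ₗ[k] B →ₗ[k] B) (t t' : H ⊗[k] B) :
    auxYR α (t + t') = auxYR α t + auxYR α t' := by
  apply LinearMap.ext
  intro x
  simp only [auxYR, LinearMap.comp_apply, LinearMap.flip_apply, LinearMap.add_apply, map_add]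

theorem auxYR_zero (α : H →ₗ[k] B →ₗ[k] B) : auxYR (k := k) α (0 : H ⊗[k] B) = 0 := by
  simp [auxYR]

/-- `p ⊗ q ↦ (p · b)₍₋₁₎ q ⊗ (p · b)₍₀₎`. -/
def auxYL (α : H →ₗ[k] B →ₗ[k] B) (ρ : B →ₗ[k] H ⊗[k] B) (b : B) :
    (H ⊗[k] H) →ₗ[k] (H ⊗[k] B) :=
  (TensorProduct.map (LinearMap.mul' k H) LinearMap.id)
            ∘ₗ (TensorProduct.assoc k H H B).symm.toLinearMap
            ∘ₗ (TensorProduct.map LinearMap.id (TensorProduct.comm k B H).toLinearMap)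
            ∘ₗ (TensorProduct.assoc k H B H).toLinearMap
            ∘ₗ (TensorProduct.map (ρ ∘ₗ α.flip b) LinearMap.id)

/-- `(x ⊗ w) ⊗ (p ⊗ (w' ⊗ q)) ↦ (a (x p · b) ⊗ (w w')₁ h) ⊗ ((w w')₂ ⊗ q h')`. -/
def auxE (α : H →ₗ[k] B →ₗ[k] B) (a b : B) (h h' : H) :
    ((H ⊗[k] (H ⊗[k] B)) ⊗[k] (H ⊗[k] ((H ⊗[k] B) ⊗[k] H)))
      →ₗ[k] ((B ⊗[k] H) ⊗[k] (B ⊗[k] H)) :=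
  (TensorProduct.map (TensorProduct.map LinearMap.id (LinearMap.mulRight k h))
      (TensorProduct.map LinearMap.id (LinearMap.mulRight k h')))
    ∘ₗ (TensorProduct.assoc k B H (B ⊗[k] H)).symm.toLinearMap
    ∘ₗ (TensorProduct.map LinearMap.id (TensorProduct.assoc k H B H).toLinearMap)
    ∘ₗ (TensorProduct.map (LinearMap.mulLeft k a ∘ₗ α.flip b ∘ₗ LinearMap.mul' k H)
        ((TensorProduct.map (LinearMap.mul' k (H ⊗[k] B)) LinearMap.id)
          ∘ₗ (TensorProduct.assoc k (H ⊗[k] B) (H ⊗[k] B) H).symm.toLinearMap))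
    ∘ₗ (TensorProduct.tensorTensorTensorComm k H (H ⊗[k] B) H ((H ⊗[k] B) ⊗[k] H)).toLinearMap

/-- `(p ⊗ p') ⊗ (q ⊗ q') ↦ p ⊗ ((p' ⊗ q) ⊗ q')`. -/
def auxR (k H : Type*) [Field k] [Semiring H] [Bialgebra k H] :
    ((H ⊗[k] H) ⊗[k] (H ⊗[k] H)) →ₗ[k] (H ⊗[k] ((H ⊗[k] H) ⊗[k] H)) :=
  (TensorProduct.map LinearMap.id (TensorProduct.assoc k H H H).symm.toLinearMap)
    ∘ₗ (TensorProduct.assoc k H H (H ⊗[k] H)).toLinearMap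

theorem auxR_comul (g : H) :
    auxR k H (TensorProduct.map Coalgebra.comul Coalgebra.comul (Coalgebra.comul (R := k) g))
      = TensorProduct.map LinearMap.id (TensorProduct.map Coalgebra.comul LinearMap.id)
          (TensorProduct.map LinearMap.id Coalgebra.comul (Coalgebra.comul (R := k) g)) := by
  have h1 : TensorProduct.map Coalgebra.comul Coalgebra.comul (Coalgebra.comul (R := k) g)
      = TensorProduct.map LinearMap.id Coalgebra.comul
        ((TensorProduct.assoc k H H H).symm
          (TensorProduct.map LinearMap.id Coalgebra.comul (Coalgebra.comul (R := k) g))) := by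
    have := Coalgebra.coassoc_symm_apply (R := k) g
    rw [LinearMap.lTensor] at this
    rw [this, LinearMap.rTensor, TensorProduct.map_map]
    rfl
  have h2 : ∀ X : H ⊗[k] (H ⊗[k] H), auxR k H (TensorProduct.map LinearMap.id Coalgebra.comul
        ((TensorProduct.assoc k H H H).symm X))
      = TensorProduct.map LinearMap.id ((TensorProduct.assoc k H H H).symm.toLinearMap
          ∘ₗ TensorProduct.map LinearMap.id Coalgebra.comul) X := by
    intro X
    induction X with
    | zero => simp
    | add x y hx hy => simp only [map_add, hx, hy]
    | tmul x y =>
      induction y with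
      | zero => simp
      | add x y hx hy => simp only [map_add, hx, hy, TensorProduct.tmul_add]
      | tmul y z => simp [auxR]
  rw [h1, h2, TensorProduct.map_map, TensorProduct.map_map]
  congr 2
  ext x
  have := Coalgebra.coassoc_symm_apply (R := k) x
  simpa [LinearMap.lTensor, LinearMap.rTensor] using this

theorem auxL_eq (α : H →ₗ[k] B →ₗ[k] B) (ρ : B →ₗ[k] H ⊗[k] B)
    (hα_mul : ∀ (g h : H) (b : B), α (g * h) b = α g (α h b))
    (hca : ∀ a b : B, ρ (a * b) = ρ a * ρ b)
    (a a' b b' : B) (h h' : H) (P Q : H ⊗[k] H) :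
    auxS ρ (auxTW α ρ ((a ⊗ₜ a') ⊗ₜ auxMC α (P ⊗ₜ (b ⊗ₜ b'))) ⊗ₜ (Q * (h ⊗ₜ h')))
      = auxE α a b h h' (TensorProduct.map LinearMap.id ρ (ρ a') ⊗ₜ
          TensorProduct.map LinearMap.id (TensorProduct.map (auxYL α ρ b') LinearMap.id)
            (auxR k H (P ⊗ₜ Q))) := by
  induction P with
  | zero => simp
  | add x y hx hy => simp only [map_add, TensorProduct.tmul_add, TensorProduct.add_tmul, hx, hy]
  | tmul p p' =>
  induction Q with
  | zero => simp
  | add x y hx hy =>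
    simp only [map_add, TensorProduct.tmul_add, TensorProduct.add_tmul, add_mul, hx, hy]
  | tmul q q' =>
  simp only [auxTW, auxMC, auxR, LinearMap.comp_apply, LinearEquiv.coe_coe,
    TensorProduct.map_tmul, LinearMap.id_apply, TensorProduct.tensorTensorTensorComm_tmul,
    TensorProduct.lift.tmul, TensorProduct.assoc_tmul, TensorProduct.assoc_symm_tmul]
  generalize ρ a' = r
  induction r with
  | zero => simp
  | add x y hx hy => simp only [map_add, TensorProduct.tmul_add, TensorProduct.add_tmul, hx, hy]
  | tmul x y =>
  simp only [auxYL, auxS, LinearMap.comp_apply, LinearEquiv.coe_coe,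
    TensorProduct.map_tmul, LinearMap.id_apply, TensorProduct.tensorTensorTensorComm_tmul,
    TensorProduct.lift.tmul, TensorProduct.assoc_tmul, TensorProduct.assoc_symm_tmul,
    LinearMap.mul'_apply, hca, LinearMap.flip_apply, Algebra.TensorProduct.tmul_mul_tmul]
  generalize ρ y = r
  generalize ρ (α p' b') = t
  induction r with
  | zero => simp
  | add x y hx hy =>
    simp only [map_add, TensorProduct.tmul_add, TensorProduct.add_tmul, add_mul, hx, hy]
  | tmul y z =>
  induction t with
  | zero => simp
  | add x y hx hy =>
    simp only [map_add, TensorProduct.tmul_add, TensorProduct.add_tmul, mul_add, hx, hy]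
  | tmul s t =>
  simp [auxE, hα_mul, mul_assoc]

set_option maxHeartbeats 1600000 in
theorem auxRHS_eq (α : H →ₗ[k] B →ₗ[k] B) (ρ : B →ₗ[k] H ⊗[k] B)
    (a a' b b' : B) (h h' : H) (g g' : H) :
    TensorProduct.map (smashMul k α) (smashMul k α)
        ((TensorProduct.tensorTensorTensorComm k
          (B ⊗[k] H) (B ⊗[k] H) (B ⊗[k] H) (B ⊗[k] H))
            (auxS ρ ((a ⊗ₜ a') ⊗ₜ (g ⊗ₜ g')) ⊗ₜ auxS ρ ((b ⊗ₜ b') ⊗ₜ (h ⊗ₜ h'))))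
      = auxE α a b h h' ((TensorProduct.assoc k H H B)
            (TensorProduct.map Coalgebra.comul LinearMap.id (ρ a')) ⊗ₜ
          TensorProduct.map LinearMap.id (TensorProduct.map (auxYR α (ρ b')) LinearMap.id)
            (auxR k H (Coalgebra.comul g ⊗ₜ Coalgebra.comul g'))) := by
  simp only [auxS, LinearMap.comp_apply, LinearEquiv.coe_coe,
    TensorProduct.map_tmul, LinearMap.id_apply]
  generalize ρ a' = r
  generalize ρ b' = t
  induction r with
  | zero => simp
  | add x y hx hy => simp only [map_add, TensorProduct.tmul_add, TensorProduct.add_tmul, hx, hy]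
  | tmul x y =>
  induction t with
  | zero => simp [auxYR_zero]
  | add x y hx hy =>
    simp only [map_add, TensorProduct.tmul_add, TensorProduct.add_tmul, hx, hy,
      auxYR_add, TensorProduct.map_add_left, TensorProduct.map_add_right,
      LinearMap.add_apply]
  | tmul s t =>
  simp only [smashMul, LinearMap.comp_apply, LinearEquiv.coe_coe,
    TensorProduct.map_tmul, LinearMap.id_apply, TensorProduct.tensorTensorTensorComm_tmul,
    TensorProduct.assoc_tmul, TensorProduct.assoc_symm_tmul, LinearMap.mul'_apply,
    Bialgebra.comul_mul]
  generalize Coalgebra.comul (R := k) x = X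
  generalize Coalgebra.comul (R := k) g = G
  generalize Coalgebra.comul (R := k) g' = G'
  induction X with
  | zero => simp
  | add x y hx hy =>
    simp only [map_add, TensorProduct.tmul_add, TensorProduct.add_tmul, add_mul, hx, hy]
  | tmul x x' =>
  induction G with
  | zero => simp
  | add x y hx hy =>
    simp only [map_add, TensorProduct.tmul_add, TensorProduct.add_tmul, mul_add, hx, hy]
  | tmul p p' =>
  induction G' with
  | zero => simp
  | add x y hx hy =>
    simp only [map_add, TensorProduct.tmul_add, TensorProduct.add_tmul, hx, hy]
  | tmul q q' =>
  simp only [auxYR, auxE, auxR, mul_assoc, LinearMap.comp_apply, LinearEquiv.coe_coe,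
    TensorProduct.map_tmul, LinearMap.id_apply, TensorProduct.tensorTensorTensorComm_tmul,
    TensorProduct.lift.tmul, TensorProduct.assoc_tmul, TensorProduct.assoc_symm_tmul,
    LinearMap.mul'_apply, LinearMap.flip_apply, Algebra.TensorProduct.tmul_mul_tmul,
    TensorProduct.mk_apply, LinearMap.mulRight_apply, LinearMap.mulLeft_apply]

theorem aux_main (α : H →ₗ[k] B →ₗ[k] B) (ρ : B →ₗ[k] H ⊗[k] B)
    (hα_mul : ∀ (g h : H) (b : B), α (g * h) b = α g (α h b))
    (hca : ∀ a b : B, ρ (a * b) = ρ a * ρ b)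
    (hρ : ∀ a, (TensorProduct.assoc k H H B)
        (TensorProduct.map Coalgebra.comul LinearMap.id (ρ a))
      = TensorProduct.map LinearMap.id ρ (ρ a))
    (hYD : ∀ (h : H) (b : B), auxYR α (ρ b) (Coalgebra.comul h) = auxYL α ρ b (Coalgebra.comul h))
    (g : H) (R : Coalgebra.Repr k g (H × H)) (A C : B ⊗[k] B) (D : H ⊗[k] H) :
    ∑ i ∈ R.index, auxS ρ (auxTW α ρ (A ⊗ₜ auxMC α (Coalgebra.comul (R.left i) ⊗ₜ C)) ⊗ₜ
        (Coalgebra.comul (R.right i) * D))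
      = ∑ i ∈ R.index, TensorProduct.map (smashMul k α) (smashMul k α)
        ((TensorProduct.tensorTensorTensorComm k
          (B ⊗[k] H) (B ⊗[k] H) (B ⊗[k] H) (B ⊗[k] H))
            (auxS ρ (A ⊗ₜ (R.left i ⊗ₜ R.right i)) ⊗ₜ auxS ρ (C ⊗ₜ D))) := by
  induction A with
  | zero => simp
  | add x y hx hy =>
    simp only [map_add, TensorProduct.tmul_add, TensorProduct.add_tmul, hx, hy,
      Finset.sum_add_distrib]
  | tmul a a' =>
  induction C with
  | zero => simp
  | add x y hx hy =>
    simp only [map_add, TensorProduct.tmul_add, TensorProduct.add_tmul, hx, hy,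
      Finset.sum_add_distrib]
  | tmul b b' =>
  induction D with
  | zero => simp
  | add x y hx hy =>
    simp only [map_add, TensorProduct.tmul_add, mul_add, hx, hy,
      Finset.sum_add_distrib]
  | tmul h h' =>
  simp only [auxL_eq α ρ hα_mul hca, auxRHS_eq, hρ]
  simp only [← map_sum, ← TensorProduct.tmul_sum]
  have hs : ∑ i ∈ R.index, Coalgebra.comul (R := k) (R.left i) ⊗ₜ[k]
      Coalgebra.comul (R := k) (R.right i)
      = TensorProduct.map Coalgebra.comul Coalgebra.comul (Coalgebra.comul (R := k) g) := by
    rw [← R.eq, map_sum]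
    rfl
  rw [hs, auxR_comul]
  congr 2
  generalize TensorProduct.map LinearMap.id Coalgebra.comul (Coalgebra.comul (R := k) g) = X
  rw [TensorProduct.map_map, TensorProduct.map_map, ← TensorProduct.map_comp,
    ← TensorProduct.map_comp]
  have hY : auxYL α ρ b' ∘ₗ Coalgebra.comul = auxYR α (ρ b') ∘ₗ Coalgebra.comul :=
    LinearMap.ext fun x => (hYD x b').symm
  rw [hY]

end Helpers

/-- under the biproduct hypotheses, the smash coproduct
comultiplication is multiplicative:
`Δ((a⋆g)(b⋆h)) = Δ(a⋆g) Δ(b⋆h)` for all `a b : B`, `g h : H`. -/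
theorem smashComul_multiplicative
    (k H B : Type*) [Field k] [Semiring H] [Bialgebra k H]
    [Ring B] [Algebra k B] [Coalgebra k B]
    (α : H →ₗ[k] B →ₗ[k] B) (ρ : B →ₗ[k] H ⊗[k] B)
    -- `B` is a left `H`-module
    (hα_one : ∀ b : B, α 1 b = b)
    (hα_mul : ∀ (g h : H) (b : B), α (g * h) b = α g (α h b))
    -- `B` is a left `H`-module algebra
    (hma : ∀ (h : H) (a b : B),
      α h (a * b) =
        LinearMap.mul' k B (TensorProduct.map (α.flip a) (α.flip b) (Coalgebra.comul h)))
    (hma1 : ∀ h : H, α h (1 : B) = Coalgebra.counit (R := k) h • (1 : B))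
    -- `B` is a left `H`-module coalgebra
    (hmc : ∀ (h : H) (b : B),
      Coalgebra.comul (R := k) (α h b) =
        (TensorProduct.map (TensorProduct.lift α) (TensorProduct.lift α))
          ((TensorProduct.tensorTensorTensorComm k H H B B)
            (Coalgebra.comul h ⊗ₜ[k] Coalgebra.comul b)))
    (hmcε : ∀ (h : H) (b : B),
      Coalgebra.counit (R := k) (α h b)
        = Coalgebra.counit (R := k) h * Coalgebra.counit (R := k) b)
    -- `B` is a left `H`-comodule
    (hρ_coassoc : (TensorProduct.assoc k H H B).toLinearMap
        ∘ₗ (TensorProduct.map Coalgebra.comul LinearMap.id) ∘ₗ ρ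
      = (TensorProduct.map LinearMap.id ρ) ∘ₗ ρ)
    (hρ_counit : (TensorProduct.lid k B).toLinearMap
        ∘ₗ (TensorProduct.map Coalgebra.counit LinearMap.id) ∘ₗ ρ = LinearMap.id)
    -- `B` is a left `H`-comodule algebra
    (hca : ∀ a b : B,
      ρ (a * b) = (TensorProduct.map (LinearMap.mul' k H) (LinearMap.mul' k B))
        ((TensorProduct.tensorTensorTensorComm k H B H B) (ρ a ⊗ₜ[k] ρ b)))
    (hca1 : ρ (1 : B) = (1 : H) ⊗ₜ[k] (1 : B))
    -- `B` is a left `H`-comodule coalgebra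
    (hcc : ∀ b : B,
      (TensorProduct.map LinearMap.id Coalgebra.comul) (ρ b)
        = (TensorProduct.map (LinearMap.mul' k H) LinearMap.id)
            ((TensorProduct.tensorTensorTensorComm k H B H B)
              ((TensorProduct.map ρ ρ) (Coalgebra.comul b))))
    (hccε : ∀ b : B,
      (TensorProduct.rid k H) ((TensorProduct.map LinearMap.id Coalgebra.counit) (ρ b))
        = Coalgebra.counit (R := k) b • (1 : H))
    -- `ε_B` is an algebra map
    (hεB_mul : ∀ a b : B,
      Coalgebra.counit (R := k) (a * b)
        = Coalgebra.counit (R := k) a * Coalgebra.counit (R := k) b)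
    (hεB_one : Coalgebra.counit (R := k) (1 : B) = 1)
    -- `Δ_B 1 = 1 ⊗ 1`
    (hΔ1 : Coalgebra.comul (R := k) (1 : B) = (1 : B) ⊗ₜ[k] (1 : B))
    -- the twisted comultiplication condition (1) of Radford's theorem:
    -- `Δ_B(ab) = Σ a₁ ((a₂)₍₋₁₎ · b₁) ⊗ (a₂)₍₀₎ b₂`
    (htw : ∀ a b : B,
      Coalgebra.comul (R := k) (a * b) =
        (TensorProduct.map
            ((LinearMap.mul' k B)
              ∘ₗ (TensorProduct.map LinearMap.id (TensorProduct.lift α))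
              ∘ₗ (TensorProduct.assoc k B H B).toLinearMap)
            (LinearMap.mul' k B))
          ((TensorProduct.tensorTensorTensorComm k (B ⊗[k] H) B B B)
            ((TensorProduct.map
                ((TensorProduct.assoc k B H B).symm.toLinearMap
                  ∘ₗ (TensorProduct.map LinearMap.id ρ))
                LinearMap.id)
              (Coalgebra.comul a ⊗ₜ[k] Coalgebra.comul b))))
    -- the Yetter–Drinfeld condition (2) of Radford's theorem:
    -- `Σ h₁ b₍₋₁₎ ⊗ h₂ · b₍₀₎ = Σ (h₁·b)₍₋₁₎ h₂ ⊗ (h₁·b)₍₀₎`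
    (hYD : ∀ (h : H) (b : B),
      (TensorProduct.map (LinearMap.mul' k H) (TensorProduct.lift α))
          ((TensorProduct.tensorTensorTensorComm k H H H B)
            (Coalgebra.comul h ⊗ₜ[k] ρ b))
        = ((TensorProduct.map (LinearMap.mul' k H) LinearMap.id)
            ∘ₗ (TensorProduct.assoc k H H B).symm.toLinearMap
            ∘ₗ (TensorProduct.map LinearMap.id (TensorProduct.comm k B H).toLinearMap)
            ∘ₗ (TensorProduct.assoc k H B H).toLinearMap
            ∘ₗ (TensorProduct.map (ρ ∘ₗ α.flip b) LinearMap.id))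
          (Coalgebra.comul h))
    :
    ∀ (a b : B) (g h : H),
      smashComul k ρ (smashMul k α ((a ⊗ₜ[k] g) ⊗ₜ[k] (b ⊗ₜ[k] h)))
        = (TensorProduct.map (smashMul k α) (smashMul k α))
            ((TensorProduct.tensorTensorTensorComm k
                (B ⊗[k] H) (B ⊗[k] H) (B ⊗[k] H) (B ⊗[k] H))
              (smashComul k ρ (a ⊗ₜ[k] g) ⊗ₜ[k] smashComul k ρ (b ⊗ₜ[k] h))) := by
  intro a b g h
  have hca' : ∀ a b : B, ρ (a * b) = ρ a * ρ b := by
    intro a b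
    rw [hca]
    generalize ρ a = r
    generalize ρ b = t
    induction r with
    | zero => simp
    | add x y hx hy => simp only [map_add, TensorProduct.add_tmul, add_mul, hx, hy]
    | tmul x y =>
    induction t with
    | zero => simp
    | add x y hx hy => simp only [map_add, TensorProduct.tmul_add, mul_add, hx, hy]
    | tmul s t => simp
  have hS : ∀ (b : B) (h : H), smashComul k ρ (b ⊗ₜ h)
      = auxS ρ (Coalgebra.comul b ⊗ₜ Coalgebra.comul h) := fun _ _ => rfl
  have htw' : ∀ a b : B, Coalgebra.comul (R := k) (a * b)
      = auxTW α ρ (Coalgebra.comul a ⊗ₜ Coalgebra.comul b) := htw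
  have hmc' : ∀ (h : H) (b : B), Coalgebra.comul (R := k) (α h b)
      = auxMC α (Coalgebra.comul h ⊗ₜ Coalgebra.comul b) := hmc
  have hM : ∀ R : Coalgebra.Repr k g (H × H), smashMul k α ((a ⊗ₜ[k] g) ⊗ₜ[k] (b ⊗ₜ[k] h))
      = ∑ i ∈ R.index, (a * α (R.left i) b) ⊗ₜ[k] (R.right i * h) := by
    intro R
    simp only [smashMul, LinearMap.comp_apply, TensorProduct.map_tmul, ← R.eq]
    simp [TensorProduct.tmul_sum, TensorProduct.sum_tmul]
  have R := Coalgebra.Repr.arbitrary k g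
  rw [hM R, map_sum]
  simp only [hS, htw', hmc', Bialgebra.comul_mul]
  rw [aux_main α ρ hα_mul hca' (fun a => LinearMap.congr_fun hρ_coassoc a) hYD]
  simp only [← map_sum, ← TensorProduct.tmul_sum, ← TensorProduct.sum_tmul, R.eq]
end
end
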